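/- arXiv:1509.02498 — 3 statements merged into one kernel-verified Lean document; each statement's English description precedes it below -/
import Mathlib

section
/- Let c < 0 and p > 0, and define φ(x) = (c+4px)/(p−x) for real x ≠ p. Then φ(x) > 0 if and only if x > 0 and |x + c/(4x)| < |p + c/(4p)|. -/
/-- Let `c < 0` and `p > 0`, and define `φ(x) = (c+4px)/(p−x)` for `x ≠ p`.
Then `φ(x) > 0` if and only if `x > 0` and `|x + c/(4x)| < |p + c/(4p)|`. -/
theorem phi_pos_iff (c p : ℝ) (hc : c < 0) (hp : 0 < p) (x : ℝ) (hx : x ≠ p) :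
    0 < (c + 4 * p * x) / (p - x) ↔
      0 < x ∧ |x + c / (4 * x)| < |p + c / (4 * p)| := by
  obtain ⟨q, hq, rfl⟩ : ∃ q : ℝ, 0 < q ∧ c = -(4 * p * q) :=
    ⟨-c / (4 * p), div_pos (by linarith) (by linarith), by field_simp⟩
  have hφ : 0 < (-(4 * p * q) + 4 * p * x) / (p - x) ↔ 0 < (x - q) * (p - x) := by
    rw [show -(4 * p * q) + 4 * p * x = 4 * p * (x - q) by ring, mul_div_assoc,
      mul_pos_iff_of_pos_left (by linarith), div_pos_iff, mul_pos_iff]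
  have hpos : 0 < (x - q) * (p - x) → 0 < x := by
    rw [mul_pos_iff]
    rintro (⟨h, -⟩ | ⟨-, h⟩) <;> linarith
  have habs (hx0 : 0 < x) :
      |x + -(4 * p * q) / (4 * x)| < |p + -(4 * p * q) / (4 * p)| ↔
        0 < (x - q) * (p - x) := by
    have hdiff : (p + -(4 * p * q) / (4 * p)) ^ 2 - (x + -(4 * p * q) / (4 * x)) ^ 2 =
        (x + p) * (x + q) / x ^ 2 * ((x - q) * (p - x)) := by
      field_simp
      ring
    rw [← sq_lt_sq, ← sub_pos, hdiff, mul_pos_iff_of_pos_left (by positivity)]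
  rw [hφ]
  exact ⟨fun h => ⟨hpos h, (habs (hpos h)).2 h⟩, fun h => (habs h.1).1 h.2⟩
end

section
/- Let c < 0, let Λ ⊆ ℝ be a nonempty finite set, and let m : ℝ → ℝ satisfy m(λ) > 0 for every λ ∈ Λ. Suppose that for every λ ∈ Λ the Cartan sum vanishes: ∑_{μ∈Λ, μ≠λ} m(μ)(c+4λμ)/(λ−μ) = 0. Then Λ has at most two elements; moreover, if Λ = {λ, μ} with λ ≠ μ, then c + 4λμ = 0. -/
/-- If `l ≠ 0` minimises `x ^ 2 + (c / 4) ^ 2 / x ^ 2` against a nonzero `μ`, then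
`l` times the Cartan numerator and denominator of the pair `(l, μ)` is nonpositive. -/
theorem mul_cartan_num_mul_sub_nonpos {c l μ : ℝ} (hc : c < 0) (hl : l ≠ 0)
    (hmin : μ ≠ 0 → l ^ 2 + (c / 4) ^ 2 / l ^ 2 ≤ μ ^ 2 + (c / 4) ^ 2 / μ ^ 2) :
    l * (c + 4 * l * μ) * (l - μ) ≤ 0 := by
  have hl2 : 0 < l ^ 2 := by positivity
  rcases le_or_gt (l * μ) 0 with h | h
  · have h1 : c + 4 * l * μ ≤ 0 := by linarith
    have h2 : 0 ≤ l * (l - μ) := by linarith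
    nlinarith [mul_nonneg h2 (neg_nonneg.2 h1)]
  · have hμ : μ ≠ 0 := right_ne_zero_of_mul h.ne'
    have hμ2 : 0 < μ ^ 2 := by positivity
    have hle : (l ^ 2 - μ ^ 2) * (16 * l ^ 2 * μ ^ 2 - c ^ 2) ≤ 0 := by
      have key : (l ^ 2 - μ ^ 2) * (16 * l ^ 2 * μ ^ 2 - c ^ 2) =
          16 * (l ^ 2 * μ ^ 2) * ((l ^ 2 + (c / 4) ^ 2 / l ^ 2) -
            (μ ^ 2 + (c / 4) ^ 2 / μ ^ 2)) := by
        field_simp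
        ring
      rw [key]
      exact mul_nonpos_of_nonneg_of_nonpos (by positivity) (sub_nonpos.2 (hmin hμ))
    have hpos : 0 < (l ^ 2 + l * μ) * (4 * (l * μ) - c) :=
      mul_pos (by linarith) (by linarith)
    refine nonpos_of_mul_nonpos_left ?_ hpos
    calc l * (c + 4 * l * μ) * (l - μ) * ((l ^ 2 + l * μ) * (4 * (l * μ) - c))
        = l ^ 2 * ((l ^ 2 - μ ^ 2) * (16 * l ^ 2 * μ ^ 2 - c ^ 2)) := by ring
      _ ≤ 0 := mul_nonpos_of_nonneg_of_nonpos hl2.le hle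


/-- Let `c < 0`, `Λ ⊆ ℝ` a nonempty finite set and `m : ℝ → ℝ` positive on `Λ`.
If the Cartan sum `∑_{μ∈Λ, μ≠λ} m(μ)(c+4λμ)/(λ−μ)` vanishes for every `λ ∈ Λ`,
then `Λ` has at most two elements, and any two distinct elements `λ, μ ∈ Λ`
satisfy `c + 4λμ = 0`. -/
theorem cartan_formula_at_most_two_curvatures (c : ℝ) (hc : c < 0)
    (Λ : Finset ℝ) (hΛ : Λ.Nonempty) (m : ℝ → ℝ) (hm : ∀ l ∈ Λ, 0 < m l)
    (hS : ∀ l ∈ Λ, (∑ μ ∈ Λ.erase l, m μ * (c + 4 * l * μ) / (l - μ)) = 0) :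
    Λ.card ≤ 2 ∧ ∀ l ∈ Λ, ∀ μ ∈ Λ, l ≠ μ → c + 4 * l * μ = 0 := by
  by_cases hne : (Λ.filter (· ≠ 0)).Nonempty
  · obtain ⟨l, hl, hmin⟩ := Finset.exists_min_image _
      (fun x : ℝ => x ^ 2 + (c / 4) ^ 2 / x ^ 2) hne
    obtain ⟨hlΛ, hl0⟩ := Finset.mem_filter.1 hl
    have hterm : ∀ μ ∈ Λ.erase l, l * (m μ * (c + 4 * l * μ) / (l - μ)) ≤ 0 := by
      intro μ hμ
      obtain ⟨hμl, hμΛ⟩ := Finset.mem_erase.1 hμ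
      have hd : l - μ ≠ 0 := sub_ne_zero.2 hμl.symm
      have key : l * (m μ * (c + 4 * l * μ) / (l - μ)) =
          m μ / (l - μ) ^ 2 * (l * (c + 4 * l * μ) * (l - μ)) := by
        field_simp
      rw [key]
      exact mul_nonpos_of_nonneg_of_nonpos (div_nonneg (hm μ hμΛ).le (sq_nonneg _))
        (mul_cartan_num_mul_sub_nonpos hc hl0
          fun h => hmin μ (Finset.mem_filter.2 ⟨hμΛ, h⟩))
    have hzero : ∀ μ ∈ Λ, μ ≠ l → c + 4 * l * μ = 0 := by
      intro μ hμΛ hμl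
      have h := (Finset.sum_eq_zero_iff_of_nonpos hterm).1
        (by rw [← Finset.mul_sum, hS l hlΛ, mul_zero]) μ (Finset.mem_erase.2 ⟨hμl, hμΛ⟩)
      simpa [hl0, (hm μ hμΛ).ne', sub_ne_zero.2 hμl.symm] using h
    have huniq : ∀ μ ∈ Λ, μ ≠ l → μ = -c / (4 * l) := by
      intro μ hμΛ hμl
      rw [eq_div_iff (by positivity)]
      linarith [hzero μ hμΛ hμl]
    constructor
    · refine (Finset.card_le_card (t := {l, -c / (4 * l)}) fun μ hμ => ?_).trans
        Finset.card_le_two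
      by_cases h : μ = l
      · simp [h]
      · simp [← huniq μ hμ h]
    · intro a ha b hb hab
      by_cases hal : a = l
      · subst hal
        exact hzero b hb hab.symm
      · by_cases hbl : b = l
        · subst hbl
          linarith [hzero a ha hal]
        · exact absurd ((huniq a ha hal).trans (huniq b hb hbl).symm) hab
  · have h0 : ∀ μ ∈ Λ, μ = 0 := by
      intro μ hμ
      by_contra h
      exact hne ⟨μ, Finset.mem_filter.2 ⟨hμ, h⟩⟩
    refine ⟨?_, fun a ha b hb hab => absurd ((h0 a ha).trans (h0 b hb).symm) hab⟩
    exact (Finset.card_le_one.2 fun a ha b hb => (h0 a ha).trans (h0 b hb).symm).trans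
      one_le_two
end

section
/- Let c < 0, let a, b ∈ ℝ with b ≠ 0, let Λ ⊆ ℝ be a nonempty finite set, and let m : ℝ → ℝ satisfy m(λ) > 0 for every λ ∈ Λ. Suppose that for every λ ∈ Λ: 2·(a(4λ²−c) − λ(4a²+4b²−c))/((λ−a)²+b²) + ∑_{μ∈Λ, μ≠λ} m(μ)(c+4λμ)/(λ−μ) = 0. Then Λ has at most two elements; a(4λ²−c) − λ(4a²+4b²−c) = 0 for every λ ∈ Λ; and if Λ = {λ, μ} with λ ≠ μ, then c + 4λμ = 0. -/
/-- The Cartan quotient `(c + 4λμ)/(λ - μ)` has the sign of `w(μ) - w(λ)`, where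
`w(x) = x/(4x² - c)`. -/
lemma cartan_quotient_nonneg {c l μ : ℝ} (hc : c < 0)
    (h : l / (4 * l ^ 2 - c) ≤ μ / (4 * μ ^ 2 - c)) : 0 ≤ (c + 4 * l * μ) / (l - μ) := by
  have hl : 0 < 4 * l ^ 2 - c := by nlinarith [sq_nonneg l]
  have hμ : 0 < 4 * μ ^ 2 - c := by nlinarith [sq_nonneg μ]
  rw [div_le_div_iff₀ hl hμ] at h
  have key : 0 ≤ (c + 4 * l * μ) * (l - μ) := by nlinarith
  rcases eq_or_ne (l - μ) 0 with h0 | h0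
  · simp [h0]
  · rw [← mul_div_mul_right _ _ h0]
    exact div_nonneg key (mul_self_nonneg _)

/-- Cartan's fundamental formula at a type IV point.  Let `c < 0`, `a, b ∈ ℝ` with
`b ≠ 0`, `Λ ⊆ ℝ` nonempty finite, and `m : ℝ → ℝ` positive on `Λ`.  If for every
`λ ∈ Λ` one has
`2(a(4λ²−c) − λ(4a²+4b²−c))/((λ−a)²+b²) + ∑_{μ∈Λ, μ≠λ} m(μ)(c+4λμ)/(λ−μ) = 0`,
then `Λ` has at most two elements, `a(4λ²−c) − λ(4a²+4b²−c) = 0` for every `λ ∈ Λ`,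
and any two distinct elements `λ, μ ∈ Λ` satisfy `c + 4λμ = 0`. -/
theorem cartan_formula_type_IV (c a b : ℝ) (hc : c < 0) (hb : b ≠ 0)
    (Λ : Finset ℝ) (hΛ : Λ.Nonempty) (m : ℝ → ℝ) (hm : ∀ l ∈ Λ, 0 < m l)
    (hS : ∀ l ∈ Λ,
      2 * (a * (4 * l ^ 2 - c) - l * (4 * a ^ 2 + 4 * b ^ 2 - c)) / ((l - a) ^ 2 + b ^ 2)
        + (∑ μ ∈ Λ.erase l, m μ * (c + 4 * l * μ) / (l - μ)) = 0) :
    Λ.card ≤ 2 ∧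
    (∀ l ∈ Λ, a * (4 * l ^ 2 - c) - l * (4 * a ^ 2 + 4 * b ^ 2 - c) = 0) ∧
    (∀ l ∈ Λ, ∀ μ ∈ Λ, l ≠ μ → c + 4 * l * μ = 0) := by
  have hpos : ∀ x : ℝ, 0 < 4 * x ^ 2 - c := fun x => by nlinarith [sq_nonneg x]
  have hB : 0 < 4 * a ^ 2 + 4 * b ^ 2 - c := by nlinarith [sq_nonneg a, sq_nonneg b]
  have hD : ∀ l : ℝ, 0 < (l - a) ^ 2 + b ^ 2 := fun l => by positivity
  let w : ℝ → ℝ := fun x => x / (4 * x ^ 2 - c)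
  obtain ⟨p, hp, hpmin⟩ := Λ.exists_min_image w hΛ
  obtain ⟨q, hq, hqmax⟩ := Λ.exists_max_image w hΛ
  have hwp : a / (4 * a ^ 2 + 4 * b ^ 2 - c) ≤ w p := by
    have hsum : 0 ≤ ∑ μ ∈ Λ.erase p, m μ * (c + 4 * p * μ) / (p - μ) := by
      refine Finset.sum_nonneg fun μ hμ => ?_
      have hμ' := Finset.mem_of_mem_erase hμ
      rw [mul_div_assoc]
      exact mul_nonneg (hm μ hμ').le (cartan_quotient_nonneg hc (hpmin μ hμ'))
    rw [div_le_div_iff₀ hB (hpos p)]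
    by_contra! hlt
    have := div_pos (a := 2 * (a * (4 * p ^ 2 - c) - p * (4 * a ^ 2 + 4 * b ^ 2 - c)))
      (by linarith) (hD p)
    linarith [hS p hp]
  have hwq : w q ≤ a / (4 * a ^ 2 + 4 * b ^ 2 - c) := by
    have hsum : ∑ μ ∈ Λ.erase q, m μ * (c + 4 * q * μ) / (q - μ) ≤ 0 := by
      refine Finset.sum_nonpos fun μ hμ => ?_
      have hμ' := Finset.mem_of_mem_erase hμ
      have hquot : 0 ≤ (c + 4 * μ * q) / (μ - q) := cartan_quotient_nonneg hc (hqmax μ hμ')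
      have hswap : (c + 4 * q * μ) / (q - μ) = -((c + 4 * μ * q) / (μ - q)) := by
        rw [← div_neg, neg_sub, mul_right_comm]
      rw [mul_div_assoc, hswap]
      exact mul_nonpos_of_nonneg_of_nonpos (hm μ hμ').le (neg_nonpos.mpr hquot)
    rw [div_le_div_iff₀ (hpos q) hB]
    by_contra! hlt
    have := div_neg_of_neg_of_pos
      (a := 2 * (a * (4 * q ^ 2 - c) - q * (4 * a ^ 2 + 4 * b ^ 2 - c))) (by linarith) (hD q)
    linarith [hS q hq]
  have hw : ∀ l ∈ Λ, w l = a / (4 * a ^ 2 + 4 * b ^ 2 - c) := fun l hl =>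
    le_antisymm ((hqmax l hl).trans hwq) (hwp.trans (hpmin l hl))
  have hpair : ∀ l ∈ Λ, ∀ μ ∈ Λ, l ≠ μ → c + 4 * l * μ = 0 := by
    intro l hl μ hμ hne
    have h : w l = w μ := (hw l hl).trans (hw μ hμ).symm
    rw [div_eq_div_iff (hpos l).ne' (hpos μ).ne'] at h
    apply mul_right_cancel₀ (sub_ne_zero.mpr hne)
    linarith
  refine ⟨?_, fun l hl => ?_, hpair⟩
  · by_contra! hcard
    obtain ⟨x, hx, y, hy, z, hz, hxy, hxz, hyz⟩ := Finset.two_lt_card.mp hcard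
    have h1 := hpair x hx y hy hxy
    have h2 := hpair x hx z hz hxz
    have h3 : x * (y - z) = 0 := by linarith
    rcases mul_eq_zero.mp h3 with h | h
    · rw [h] at h1
      linarith
    · exact hyz (sub_eq_zero.mp h)
  · have h := hw l hl
    rw [div_eq_div_iff (hpos l).ne' hB.ne'] at h
    linarith
end
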